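/- arXiv:2010.00657 — 2 statements merged into one kernel-verified Lean document; each statement's English description precedes it below -/
import Mathlib

section
/- Let O be an integral domain of characteristic zero whose group of units contains an element of order equal to the exponent of a finite abelian group G (so that every character of G can be realized with values in O^*, and the evaluation map O[G] → ∏_{ψ ∈ Ĝ} O, x ↦ (ψ(x))_ψ, is injective). Let I ⊆ G be a subgroup and set N I = ∑_{σ ∈ I} σ ∈ O[G]. Then the kernel of the O-algebra homomorphism O[G] → ∏_{ψ ∈ Ĝ, ψ(I) ≠ 1} O sending x to the tuple (ψ(x))_ψ indexed by the characters ψ of G that are nontrivial on I is exactly the principal ideal of O[G] generated by N I. -/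
theorem char_inj {O : Type*} [CommRing O] [IsDomain O]
    {G : Type*} [CommGroup G] [Fintype G]
    (hroot : ∃ u : Oˣ, orderOf u = Monoid.exponent G) (y : MonoidAlgebra O G)
    (hy : ∀ ψ : G →* Oˣ, MonoidAlgebra.lift O O G ((Units.coeHom O).comp ψ) y = 0) :
    y = 0 := by
  obtain ⟨u, hu⟩ := hroot
  have hne : NeZero (Monoid.exponent G) := ⟨Monoid.exponent_ne_zero_of_finite⟩
  have hE : HasEnoughRootsOfUnity O (Monoid.exponent G) :=
    ⟨⟨(u : O), IsPrimitiveRoot.coe_units_iff.2 (hu ▸ IsPrimitiveRoot.orderOf u)⟩, inferInstance⟩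
  let ev : G → ((G →* Oˣ) →* O) := fun g => (Units.coeHom O).comp (MonoidHom.eval g)
  have hev : Function.Injective ev := by
    intro g g' h
    refine (CommGroup.forall_apply_eq_apply_iff G (M := O)).1 fun φ => ?_
    have := DFunLike.congr_fun h φ
    exact Units.ext this
  have hli := (linearIndependent_monoidHom (G →* Oˣ) O).comp ev hev
  rw [← MonoidAlgebra.coeff_eq_zero]
  refine (linearIndependent_iff.1 hli) y.coeff ?_
  funext ψ
  have := hy ψ
  rw [MonoidAlgebra.lift_apply, Finsupp.sum] at this
  rw [Finsupp.linearCombination_apply, Finsupp.sum, Finset.sum_apply]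
  exact this


/-- Let `O` be an integral domain of characteristic zero whose unit group contains an element
of order equal to the exponent of the finite abelian group `G`.  Let `I ⊆ G` be a subgroup and
`N I = ∑_{σ ∈ I} σ ∈ O[G]`.  Then the kernel of the `O`-algebra map
`O[G] → ∏_{ψ ∈ Ĝ, ψ(I) ≠ 1} O`, `x ↦ (ψ(x))_ψ`, is exactly the principal ideal `(N I)`. -/
theorem stmt_0 {O : Type*} [CommRing O] [IsDomain O] [CharZero O]
    {G : Type*} [CommGroup G] [Fintype G]
    (hroot : ∃ u : Oˣ, orderOf u = Monoid.exponent G)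
    (I : Subgroup G) [Fintype I] (x : MonoidAlgebra O G) :
    (∀ ψ : G →* Oˣ, (∃ σ ∈ I, ψ σ ≠ 1) →
        MonoidAlgebra.lift O O G ((Units.coeHom O).comp ψ) x = 0) ↔
      x ∈ Ideal.span {∑ σ : I, MonoidAlgebra.of O G (σ : G)} := by
  classical
  constructor
  · intro hx
    have hinv : ∀ τ ∈ I, MonoidAlgebra.of O G τ * x = x := by
      intro τ hτ
      rw [← sub_eq_zero]
      refine char_inj hroot _ fun ψ => ?_
      rw [map_sub, map_mul, MonoidAlgebra.lift_of]
      by_cases h : ∃ σ ∈ I, ψ σ ≠ 1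
      · rw [hx ψ h]; simp
      · push Not at h
        simp [h τ hτ]
    have hc : ∀ τ ∈ I, ∀ g, x.coeff (τ⁻¹ * g) = x.coeff g := by
      intro τ hτ g
      have := congrArg (fun z => z.coeff g) (hinv τ hτ)
      simpa [MonoidAlgebra.of_apply] using this
    rw [Ideal.mem_span_singleton']
    let r : G → G := fun g => (Quotient.out (QuotientGroup.mk g : G ⧸ I))
    have hr : ∀ g, ∃ σ ∈ I, r g = σ⁻¹ * g := by
      intro g
      refine ⟨g * (r g)⁻¹, ?_, by group⟩
      have : (QuotientGroup.mk (r g) : G ⧸ I) = QuotientGroup.mk g := Quotient.out_eq _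
      rw [mul_comm]
      exact QuotientGroup.eq.1 this
    have hrI : ∀ σ ∈ I, ∀ g, r (σ⁻¹ * g) = r g := by
      intro σ hσ g
      have : (QuotientGroup.mk (σ⁻¹ * g) : G ⧸ I) = QuotientGroup.mk g := by
        rw [QuotientGroup.eq]; simpa using hσ
      simp only [r, this]
    let z : MonoidAlgebra O G :=
      MonoidAlgebra.ofCoeff (Finsupp.equivFunOnFinite.symm fun g => if r g = g then x.coeff g else 0)
    refine ⟨z, ?_⟩
    ext g
    rw [mul_comm, Finset.sum_mul, MonoidAlgebra.coeff_sum, Finset.sum_apply']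
    have hz : ∀ k, z.coeff k = if r k = k then x.coeff k else 0 := fun k => rfl
    obtain ⟨σ, hσ, hσg⟩ := hr g
    rw [Finset.sum_eq_single (⟨σ, hσ⟩ : I)]
    · simp [MonoidAlgebra.of_apply, hz, hrI σ hσ, hσg, hc σ hσ]
    · intro b _ hb
      have : ¬ (σ⁻¹ * g = (b : G)⁻¹ * g) := by
        intro h
        apply hb
        ext
        simpa using h.symm
      simp [MonoidAlgebra.of_apply, hz, hrI b b.2, hσg, this]
    · simp
  · rintro hx ψ ⟨σ, hσ, hne⟩
    obtain ⟨a, rfl⟩ := Ideal.mem_span_singleton'.1 hx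
    rw [map_mul, map_sum]
    have := sum_hom_units_eq_zero (((Units.coeHom O).comp ψ).comp I.subtype) (by
      intro h
      apply hne
      have := DFunLike.congr_fun h ⟨σ, hσ⟩
      exact Units.ext this)
    simp only [MonoidAlgebra.lift_of]
    erw [this]
    simp
end

section
/- Let O be a commutative ring, H a finite abelian group, τ ∈ H, and let I = ⟨τ⟩ be the cyclic subgroup generated by τ; write N I = ∑_{σ ∈ I} σ ∈ O[H]. Let u ∈ O[H] be an element whose image in the quotient ring O[H]/(τ − 1) is a non-zerodivisor. Then the sequence 0 → O[H]/(N I, u) → O[H]/(u) → O[H]/(τ − 1, u) → 0, in which the first nontrivial map is multiplication by τ − 1 and the second is the natural projection, is a short exact sequence of O[H]-modules. -/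
theorem tau_mul_norm {O : Type*} [CommRing O] {H : Type*} [CommGroup H] [Fintype H] (τ : H) :
    (MonoidAlgebra.of O H τ - 1) * (∑ σ ∈ (Subgroup.zpowers τ : Set H).toFinite.toFinset,
        MonoidAlgebra.of O H σ) = 0 := by
  rw [sub_mul, one_mul, sub_eq_zero, Finset.mul_sum]
  refine Finset.sum_bij' (fun σ _ => τ * σ) (fun σ _ => τ⁻¹ * σ) ?_ ?_ ?_ ?_ ?_
  · intro a ha
    simp only [Set.Finite.mem_toFinset, SetLike.mem_coe] at ha ⊢
    exact mul_mem (Subgroup.mem_zpowers τ) ha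
  · intro a ha
    simp only [Set.Finite.mem_toFinset, SetLike.mem_coe] at ha ⊢
    exact mul_mem (inv_mem (Subgroup.mem_zpowers τ)) ha
  · intro a _; simp
  · intro a _; simp
  · intro a _; rw [map_mul]

theorem ann_tau {O : Type*} [CommRing O] {H : Type*} [CommGroup H] [Fintype H] (τ : H)
    (x : MonoidAlgebra O H) (hx : (MonoidAlgebra.of O H τ - 1) * x = 0) :
    ∃ y, x = (∑ σ ∈ (Subgroup.zpowers τ : Set H).toFinite.toFinset,
        MonoidAlgebra.of O H σ) * y := by
  classical
  have h1 : ∀ σ ∈ Subgroup.zpowers τ, MonoidAlgebra.of O H σ * x = x := by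
    intro σ hσ
    obtain ⟨n, rfl⟩ := (mem_powers_iff_mem_zpowers.2 hσ : σ ∈ Submonoid.powers τ)
    have h0 : MonoidAlgebra.of O H τ * x = x := by
      rwa [sub_mul, one_mul, sub_eq_zero] at hx
    induction n with
    | zero => simp only [pow_zero, map_one, one_mul]
    | succ k ih =>
      simp only [pow_succ, map_mul] at ih ⊢
      rw [mul_assoc, h0]
      exact ih (by simpa using pow_mem (Subgroup.mem_zpowers τ) k)
  have h2 : ∀ σ ∈ Subgroup.zpowers τ, ∀ g, x.coeff (σ⁻¹ * g) = x.coeff g := by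
    intro σ hσ g
    have := congrArg (fun z => z.coeff g) (h1 σ hσ)
    simpa [MonoidAlgebra.of_apply] using this
  let r : H → H := fun h => (QuotientGroup.mk h : H ⧸ Subgroup.zpowers τ).out
  have hr : ∀ h, (r h)⁻¹ * h ∈ Subgroup.zpowers τ := fun h =>
    QuotientGroup.eq.1 (Quotient.out_eq' _)
  have hr2 : ∀ σ ∈ Subgroup.zpowers τ, ∀ g, r (σ⁻¹ * g) = r g := by
    intro σ hσ g
    have : (QuotientGroup.mk (σ⁻¹ * g) : H ⧸ Subgroup.zpowers τ) = QuotientGroup.mk g := by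
      rw [QuotientGroup.eq]
      simpa using hσ
    simp only [r, this]
  refine ⟨MonoidAlgebra.ofCoeff (x.coeff.filter (fun h => h = r h)), ?_⟩
  ext g
  rw [Finset.sum_mul, MonoidAlgebra.coeff_sum, Finsupp.finsetSum_apply]
  simp only [MonoidAlgebra.of_apply, MonoidAlgebra.coeff_single_mul_apply, one_mul,
    MonoidAlgebra.coeff_ofCoeff]
  rw [Finset.sum_eq_single ((r g)⁻¹ * g)]
  · rw [Finsupp.filter_apply_pos, h2 _ (hr g)]
    rw [hr2 _ (hr g)]
    group
    try simp
  · intro σ hσ hne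
    simp only [Set.Finite.mem_toFinset, SetLike.mem_coe] at hσ
    rw [Finsupp.filter_apply_neg]
    rw [hr2 _ hσ]
    intro h
    apply hne
    rw [← h]
    simp [mul_comm]
  · intro h
    exact absurd (by simpa using hr g) h


/-- Let `H` be a finite abelian group, `τ ∈ H`, `I = ⟨τ⟩`, `N I = ∑_{σ ∈ I} σ ∈ O[H]`, and
let `u ∈ O[H]` have non-zerodivisor image in `O[H]/(τ - 1)`.  Then
`0 → O[H]/(N I, u) → O[H]/(u) → O[H]/(τ - 1, u) → 0` is a short exact sequence, where the
first nontrivial map is multiplication by `τ - 1` and the second is the projection.  This is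
expressed by: (i) multiplication by `τ - 1` maps `(N I, u)` into `(u)` (well-definedness),
(ii) it is injective on the quotients, (iii) the kernel of the projection is exactly the
image of multiplication by `τ - 1`, (iv) the projection is surjective. -/
theorem stmt_8 {O : Type*} [CommRing O] {H : Type*} [CommGroup H] [Fintype H]
    (τ : H) (u : MonoidAlgebra O H)
    (hu : Ideal.Quotient.mk (Ideal.span {MonoidAlgebra.of O H τ - 1}) u ∈
      nonZeroDivisors (MonoidAlgebra O H ⧸ Ideal.span {MonoidAlgebra.of O H τ - 1})) :
    (∀ a ∈ Ideal.span {(∑ σ ∈ (Subgroup.zpowers τ : Set H).toFinite.toFinset,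
        MonoidAlgebra.of O H σ), u},
      (MonoidAlgebra.of O H τ - 1) * a ∈ Ideal.span {u}) ∧
    (∀ a : MonoidAlgebra O H,
      (MonoidAlgebra.of O H τ - 1) * a ∈ Ideal.span {u} →
      a ∈ Ideal.span {(∑ σ ∈ (Subgroup.zpowers τ : Set H).toFinite.toFinset,
        MonoidAlgebra.of O H σ), u}) ∧
    (∀ b : MonoidAlgebra O H,
      b ∈ Ideal.span {MonoidAlgebra.of O H τ - 1, u} ↔
      ∃ a : MonoidAlgebra O H, b - (MonoidAlgebra.of O H τ - 1) * a ∈ Ideal.span {u}) ∧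
    Function.Surjective
      (Ideal.Quotient.factor (S := Ideal.span {u})
        (T := Ideal.span {MonoidAlgebra.of O H τ - 1, u}) (Ideal.span_mono (by simp))) := by
  refine ⟨?_, ?_, ?_, ?_⟩
  · intro a ha
    obtain ⟨p, q, rfl⟩ := Ideal.mem_span_pair.1 ha
    rw [Ideal.mem_span_singleton']
    refine ⟨(MonoidAlgebra.of O H τ - 1) * q, ?_⟩
    linear_combination (-p) * tau_mul_norm (O := O) τ
  · intro a ha
    obtain ⟨c, hc⟩ := Ideal.mem_span_singleton'.1 ha
    have h1 : Ideal.Quotient.mk (Ideal.span {MonoidAlgebra.of O H τ - 1}) c = 0 := by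
      refine (mem_nonZeroDivisors_iff.1 hu).2 _ ?_
      rw [← map_mul, hc, Ideal.Quotient.eq_zero_iff_mem, Ideal.mem_span_singleton]
      exact dvd_mul_right _ _
    rw [Ideal.Quotient.eq_zero_iff_mem, Ideal.mem_span_singleton'] at h1
    obtain ⟨d, rfl⟩ := h1
    obtain ⟨y, hy⟩ := ann_tau τ (a - d * u) (by linear_combination -hc)
    rw [Ideal.mem_span_pair]
    exact ⟨y, d, by linear_combination -hy⟩
  · intro b
    rw [Ideal.mem_span_pair]
    simp only [Ideal.mem_span_singleton']
    constructor
    · rintro ⟨p, q, rfl⟩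
      exact ⟨p, q, by ring⟩
    · rintro ⟨a, q, h⟩
      exact ⟨a, q, by linear_combination h⟩
  · exact Ideal.Quotient.factor_surjective _
end
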